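/- D ∩ T^k(D) = ∅ for all positive integers k if and only if D ∩ T̃^k(D) = ∅ for all positive integers k. -/

import Mathlib

open Set

noncomputable section

/-- `bpt a k = a_1 + ⋯ + a_k` (0-indexed: the sum of the first `k` entries of `a`);
these are the division points `b_k` of the interval exchange. -/
def bpt {n : ℕ} (a : Fin n → ℝ) (k : ℕ) : ℝ :=
  ∑ j ∈ Finset.univ.filter (fun j : Fin n => (j : ℕ) < k), a j

/-- The left-closed right-open interval `J_i = [b_{i-1}, b_i)` (0-indexed). -/
def Jint {n : ℕ} (a : Fin n → ℝ) (i : Fin n) : Set ℝ :=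
  Set.Ico (bpt a (i : ℕ)) (bpt a ((i : ℕ) + 1))

/-- The left-open right-closed interval `J̃_i = (b_{i-1}, b_i]` (0-indexed). -/
def Jtil {n : ℕ} (a : Fin n → ℝ) (i : Fin n) : Set ℝ :=
  Set.Ioc (bpt a (i : ℕ)) (bpt a ((i : ℕ) + 1))

/-- The permuted probability vector `a^τ`, with `a^τ_{τ(i)} = a_i`. -/
def aperm {n : ℕ} (a : Fin n → ℝ) (τ : Equiv.Perm (Fin n)) : Fin n → ℝ :=
  fun j => a (τ.symm j)

/-- The set `D = {b_1, …, b_{n-1}}` of interior division points. -/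
def Dset {n : ℕ} (a : Fin n → ℝ) : Set ℝ :=
  {x | ∃ k : ℕ, 0 < k ∧ k < n ∧ x = bpt a k}

/-- `a` is a positive probability vector. -/
def IsProbVec {n : ℕ} (a : Fin n → ℝ) : Prop :=
  (∀ i, 0 < a i) ∧ ∑ i, a i = 1

/-- `T` is the Lr `(a,τ)` interval exchange transformation: on each
`J_i = [b_{i-1}, b_i)` it is the translation `x ↦ x - b_{i-1} + b^τ_{τ(i)-1}`. -/
def IsLrIET {n : ℕ} (a : Fin n → ℝ) (τ : Equiv.Perm (Fin n)) (T : ℝ → ℝ) : Prop :=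
  ∀ i : Fin n, ∀ x ∈ Jint a i, T x = x - bpt a (i : ℕ) + bpt (aperm a τ) ((τ i : ℕ))

/-- `Tt` is the dual lR `(a,τ)` interval exchange transformation: on each
`J̃_i = (b_{i-1}, b_i]` it is the translation `x ↦ x - b_{i-1} + b^τ_{τ(i)-1}`. -/
def IslRIET {n : ℕ} (a : Fin n → ℝ) (τ : Equiv.Perm (Fin n)) (Tt : ℝ → ℝ) : Prop :=
  ∀ i : Fin n, ∀ x ∈ Jtil a i, Tt x = x - bpt a (i : ℕ) + bpt (aperm a τ) ((τ i : ℕ))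

/-- The Keane Condition: `D ∩ T^k(D) = ∅` for every positive integer `k`. -/
def KeaneCond {n : ℕ} (a : Fin n → ℝ) (T : ℝ → ℝ) : Prop :=
  ∀ k : ℕ, 0 < k → Dset a ∩ (T^[k] '' Dset a) = ∅

/-- `τ` is irreducible: `τ({1,…,j}) ≠ {1,…,j}` for `j = 1, …, n-1` (0-indexed:
no proper initial segment is invariant). -/
def IrreduciblePerm {n : ℕ} (τ : Equiv.Perm (Fin n)) : Prop :=
  ∀ j : ℕ, 0 < j → j < n →
    (fun i => τ i) '' {i : Fin n | (i : ℕ) < j} ≠ {i : Fin n | (i : ℕ) < j}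

/-- `P` is the family of ℤ-iterates of `T` on `[0,1)`: `P 0 = id`,
`P (k+1) = T ∘ P k`, and each `P k` maps `[0,1)` into itself. -/
def IsZIterLr (T : ℝ → ℝ) (P : ℤ → ℝ → ℝ) : Prop :=
  (∀ x ∈ Set.Ico (0 : ℝ) 1, P 0 x = x) ∧
  ∀ k : ℤ, ∀ x ∈ Set.Ico (0 : ℝ) 1, P k x ∈ Set.Ico (0 : ℝ) 1 ∧ P (k + 1) x = T (P k x)

/-- `Pt` is the family of ℤ-iterates of `Tt` on `(0,1]`. -/
def IsZIterlR (Tt : ℝ → ℝ) (Pt : ℤ → ℝ → ℝ) : Prop :=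
  (∀ x ∈ Set.Ioc (0 : ℝ) 1, Pt 0 x = x) ∧
  ∀ k : ℤ, ∀ x ∈ Set.Ioc (0 : ℝ) 1, Pt k x ∈ Set.Ioc (0 : ℝ) 1 ∧ Pt (k + 1) x = Tt (Pt k x)

/-- `I` is the itinerary map of `T` (with ℤ-iterates `P`):
`𝓘(x)_k = i ↔ T^k x ∈ J_i` for `x ∈ [0,1)`. -/
def IsItin {n : ℕ} (a : Fin n → ℝ) (P : ℤ → ℝ → ℝ) (I : ℝ → ℤ → Fin n) : Prop :=
  ∀ x ∈ Set.Ico (0 : ℝ) 1, ∀ k : ℤ, ∀ i : Fin n, (I x k = i ↔ P k x ∈ Jint a i)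

/-- `It` is the itinerary map of `Tt` (with ℤ-iterates `Pt`):
`𝓘̃(x)_k = i ↔ T̃^k x ∈ J̃_i` for `x ∈ (0,1]`. -/
def IsItinDual {n : ℕ} (a : Fin n → ℝ) (Pt : ℤ → ℝ → ℝ) (It : ℝ → ℤ → Fin n) : Prop :=
  ∀ x ∈ Set.Ioc (0 : ℝ) 1, ∀ k : ℤ, ∀ i : Fin n, (It x k = i ↔ Pt k x ∈ Jtil a i)

/-- `D_∞ = {0,1} ∪ ⋃_{k ∈ ℤ} T^k(D)`. -/
def Dinf {n : ℕ} (a : Fin n → ℝ) (P : ℤ → ℝ → ℝ) : Set ℝ :=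
  {0, 1} ∪ ⋃ k : ℤ, P k '' Dset a

/-- The set `R = [0,1] ∖ D_∞` of regular points. -/
def Rset {n : ℕ} (a : Fin n → ℝ) (P : ℤ → ℝ → ℝ) : Set ℝ :=
  Set.Icc 0 1 \ Dinf a P

/-- The shift `S` on `Ω = {1,…,n}^ℤ`: `S(α)_i = α_{i+1}`. -/
def shiftS {n : ℕ} (α : ℤ → Fin n) : ℤ → Fin n := fun i => α (i + 1)

/-- The `k`-th power of the shift: `(S^k α)_i = α_{i+k}`. -/
def shiftZ {n : ℕ} (k : ℤ) (α : ℤ → Fin n) : ℤ → Fin n := fun i => α (i + k)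

/-- `α, β` are positively asymptotic: `α_i = β_i` for all `i ≥ N`, some `N`. -/
def PosAsymp {n : ℕ} (α β : ℤ → Fin n) : Prop :=
  ∃ N : ℕ, ∀ i : ℤ, (N : ℤ) ≤ i → α i = β i

/-- `α, β` are negatively asymptotic: `α_i = β_i` for all `i ≤ -N`, some `N`. -/
def NegAsymp {n : ℕ} (α β : ℤ → Fin n) : Prop :=
  ∃ N : ℕ, ∀ i : ℤ, i ≤ -(N : ℤ) → α i = β i

/-- Let `T` and `S` be maps which agree on `I \ D`, with `T` injective on `I ∪ {p}`, such that
every value of `T` on `D ∪ {p}` other than `p` is a value of `S` on `D ∪ {q}`. If a point of `D`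
returns to `D` under `T`, then some point of `D` returns to `D` under `S`. -/
theorem exists_iterate_mem_of_exists_iterate_mem {X : Type*} {T S : X → X} {I D : Set X} {p q : X}
    (hDI : D ⊆ I) (hp : p ∉ I) (hq : q ∉ insert p I)
    (hmaps : MapsTo T (insert p I) (insert p I)) (hinj : InjOn T (insert p I))
    (heq : ∀ x ∈ I, x ∉ D → T x = S x)
    (hval : ∀ x ∈ insert p D, T x = p ∨ ∃ y ∈ insert q D, S y = T x)
    (hTp : ∃ x ∈ insert p D, T x = p) (hSq : ∃ y ∈ insert q D, S y = q)
    (h : ∃ k : ℕ, 0 < k ∧ ∃ x ∈ D, T^[k] x ∈ D) :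
    ∃ k : ℕ, 0 < k ∧ ∃ x ∈ D, S^[k] x ∈ D := by
  classical
  have hDpI : insert p D ⊆ insert p I := insert_subset_insert hDI
  have henter : ∀ x ∈ insert p D, T x ≠ p → ∃ y ∈ D, ∃ j : ℕ, 0 < j ∧ S^[j] y = T x := by
    intro x hx hxp
    obtain ⟨y, hy, hyx⟩ := (hval x hx).resolve_left hxp
    rcases hy with rfl | hy
    · obtain ⟨z, hz, hzq⟩ := hSq
      rcases hz with rfl | hz
      · exact absurd (hzq ▸ hyx ▸ hmaps (hDpI hx)) hq
      · exact ⟨z, hz, 2, by norm_num, by simp [hzq, hyx]⟩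
    · exact ⟨y, hy, 1, one_pos, hyx⟩
  obtain ⟨hk, x, hxD, hkD⟩ := Nat.find_spec h
  have hmin : ∀ i, 0 < i → i < Nat.find h → T^[i] x ∉ D := fun i hi hik hiD =>
    Nat.find_min h hik ⟨hi, x, hxD, hiD⟩
  generalize Nat.find h = k at hk hkD hmin
  have hxI : x ∈ insert p I := mem_insert_of_mem _ (hDI hxD)
  have hxp : x ≠ p := fun e => hp (e ▸ hDI hxD)
  have horbit : ∀ i, T^[i] x ∈ insert p I := fun i => hmaps.iterate i hxI
  have hreturn : ∀ i, 0 < i → T^[i] x = p → T p ≠ p := fun i _ hi hpp =>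
    hxp (hinj.iterate hmaps i hxI (mem_insert _ _)
      (hi.trans (Function.iterate_fixed hpp i).symm))
  have hnot : ∀ i, 2 ≤ i → i < k → T^[i] x ∈ I := by
    intro i hi hik
    refine (horbit i).resolve_left fun hip => ?_
    obtain ⟨y, hy, hyp⟩ := hTp
    obtain ⟨i, rfl⟩ := Nat.exists_eq_add_of_le' (show 1 ≤ i by omega)
    have hpre : T^[i] x = y := hinj (horbit i) (hDpI hy) <| by
      rw [hyp, ← hip, Function.iterate_succ_apply']
    rcases hy with rfl | hy
    · exact hreturn (i + 1) (by omega) hip hyp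
    · exact hmin i (by omega) (by omega) (hpre ▸ hy)
  have hfollow : ∀ m, 0 < m → m ≤ k → (∀ i, m ≤ i → i < k → T^[i] x ∈ I) →
      (∃ y ∈ D, ∃ j : ℕ, 0 < j ∧ S^[j] y = T^[m] x) →
      ∃ k : ℕ, 0 < k ∧ ∃ x ∈ D, S^[k] x ∈ D := by
    rintro m hm hmk hI ⟨y, hy, j, hj, hjm⟩
    have hstep : ∀ i, m + i ≤ k → S^[j + i] y = T^[m + i] x := by
      intro i
      induction i with
      | zero => exact fun _ => hjm
      | succ i ih =>
        intro hi
        rw [← add_assoc, ← add_assoc, Function.iterate_succ_apply', Function.iterate_succ_apply',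
          ih (by omega), heq _ (hI _ (by omega) (by omega)) (hmin _ (by omega) (by omega))]
    refine ⟨j + (k - m), by omega, y, hy, ?_⟩
    rw [hstep _ (by omega), Nat.add_sub_cancel' hmk]
    exact hkD
  by_cases hTx : T x = p
  · have hk2 : 2 ≤ k := by
      by_contra hlt
      obtain rfl : k = 1 := by omega
      exact hp (hTx ▸ hDI hkD)
    refine hfollow 2 two_pos hk2 hnot ?_
    simpa [hTx] using henter p (mem_insert _ _) (hreturn 1 one_pos hTx)
  · refine hfollow 1 one_pos hk (fun i hi hik => ?_) (henter x (mem_insert_of_mem _ hxD) hTx)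
    rcases hi.eq_or_lt with rfl | hi
    · exact (horbit 1).resolve_left hTx
    · exact hnot i hi hik

theorem bpt_zero {n : ℕ} (a : Fin n → ℝ) : bpt a 0 = 0 := by
  simp [bpt]

theorem bpt_card {n : ℕ} (a : Fin n → ℝ) : bpt a n = ∑ i, a i := by
  simp [bpt]

theorem bpt_succ {n : ℕ} (a : Fin n → ℝ) (i : Fin n) :
    bpt a ((i : ℕ) + 1) = bpt a (i : ℕ) + a i := by
  have : Finset.univ.filter (fun j : Fin n => (j : ℕ) < (i : ℕ) + 1) =
      insert i (Finset.univ.filter (fun j : Fin n => (j : ℕ) < (i : ℕ))) := by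
    ext j
    simp only [Finset.mem_filter, Finset.mem_univ, true_and, Finset.mem_insert, Fin.ext_iff]
    omega
  rw [bpt, this, Finset.sum_insert (by simp), add_comm]
  rfl

theorem IsProbVec.aperm {n : ℕ} {a : Fin n → ℝ} (ha : IsProbVec a) (τ : Equiv.Perm (Fin n)) :
    IsProbVec (aperm a τ) :=
  ⟨fun _ => ha.1 _, (Equiv.sum_comp τ.symm a).trans ha.2⟩

theorem IsProbVec.bpt_card {n : ℕ} {a : Fin n → ℝ} (ha : IsProbVec a) : bpt a n = 1 :=
  (_root_.bpt_card a).trans ha.2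

theorem IsProbVec.bpt_mono {n : ℕ} {a : Fin n → ℝ} (ha : IsProbVec a) : Monotone (bpt a) :=
  fun _ _ hkl => Finset.sum_le_sum_of_subset_of_nonneg
    (fun j hj => by simp only [Finset.mem_filter] at hj ⊢; exact ⟨hj.1, hj.2.trans_le hkl⟩)
    fun j _ _ => (ha.1 j).le

theorem IsProbVec.bpt_lt {n : ℕ} {a : Fin n → ℝ} (ha : IsProbVec a) {k l : ℕ} (hkl : k < l)
    (hk : k < n) : bpt a k < bpt a l := by
  have h₁ := bpt_succ a ⟨k, hk⟩
  have h₂ := ha.1 ⟨k, hk⟩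
  have h₃ := ha.bpt_mono (Nat.succ_le_of_lt hkl)
  simp only [Nat.succ_eq_add_one] at h₁ h₃
  linarith

theorem IsProbVec.Dset_subset {n : ℕ} {a : Fin n → ℝ} (ha : IsProbVec a) :
    Dset a ⊆ Ioo 0 1 := by
  rintro _ ⟨k, hk, hkn, rfl⟩
  exact ⟨bpt_zero a ▸ ha.bpt_lt hk (by omega), ha.bpt_card ▸ ha.bpt_lt hkn hkn⟩

theorem mem_insert_zero_Dset_iff {n : ℕ} (hn : 0 < n) (a : Fin n → ℝ) (x : ℝ) :
    x ∈ insert 0 (Dset a) ↔ ∃ i : Fin n, x = bpt a (i : ℕ) := by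
  constructor
  · rintro (rfl | ⟨k, -, hk, rfl⟩)
    · exact ⟨⟨0, hn⟩, (bpt_zero a).symm⟩
    · exact ⟨⟨k, hk⟩, rfl⟩
  · rintro ⟨i, rfl⟩
    rcases Nat.eq_zero_or_pos (i : ℕ) with hi | hi
    · exact Or.inl (hi ▸ bpt_zero a)
    · exact Or.inr ⟨i, hi, i.isLt, rfl⟩

theorem IsProbVec.mem_insert_one_Dset_iff {n : ℕ} (hn : 0 < n) {a : Fin n → ℝ} (ha : IsProbVec a)
    (x : ℝ) : x ∈ insert 1 (Dset a) ↔ ∃ i : Fin n, x = bpt a ((i : ℕ) + 1) := by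
  constructor
  · rintro (rfl | ⟨k, hk, hkn, rfl⟩)
    · exact ⟨⟨n - 1, by omega⟩, by simp [Nat.sub_add_cancel hn, ha.bpt_card]⟩
    · exact ⟨⟨k - 1, by omega⟩, by simp [Nat.sub_add_cancel hk]⟩
  · rintro ⟨i, rfl⟩
    rcases (Nat.succ_le_of_lt i.isLt).eq_or_lt with hi | hi
    · exact Or.inl (by rw [← Nat.succ_eq_add_one, hi, ha.bpt_card])
    · exact Or.inr ⟨i + 1, by omega, hi, rfl⟩

theorem IsProbVec.Jint_subset {n : ℕ} {a : Fin n → ℝ} (ha : IsProbVec a) (i : Fin n) :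
    Jint a i ⊆ Ico 0 1 :=
  Ico_subset_Ico (bpt_zero a ▸ ha.bpt_mono (Nat.zero_le _))
    (ha.bpt_card ▸ ha.bpt_mono (Nat.succ_le_of_lt i.isLt))

theorem IsProbVec.Jtil_subset {n : ℕ} {a : Fin n → ℝ} (ha : IsProbVec a) (i : Fin n) :
    Jtil a i ⊆ Ioc 0 1 :=
  Ioc_subset_Ioc (bpt_zero a ▸ ha.bpt_mono (Nat.zero_le _))
    (ha.bpt_card ▸ ha.bpt_mono (Nat.succ_le_of_lt i.isLt))

theorem IsProbVec.exists_mem_Jint {n : ℕ} {a : Fin n → ℝ} (ha : IsProbVec a) {x : ℝ}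
    (hx : x ∈ Ico (0 : ℝ) 1) : ∃ i, x ∈ Jint a i := by
  classical
  have hex : ∃ k, x < bpt a k := ⟨n, ha.bpt_card ▸ hx.2⟩
  have hspec := Nat.find_spec hex
  have hle : Nat.find hex ≤ n := Nat.find_min' hex (ha.bpt_card ▸ hx.2)
  obtain ⟨k, hk⟩ : ∃ k, Nat.find hex = k + 1 := Nat.exists_eq_succ_of_ne_zero fun h0 => by
    rw [h0, bpt_zero] at hspec
    exact hspec.not_ge hx.1
  exact ⟨⟨k, by omega⟩, not_lt.1 (Nat.find_min hex (k.lt_succ_self.trans_eq hk.symm)), hk ▸ hspec⟩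

theorem IsProbVec.exists_mem_Jtil {n : ℕ} {a : Fin n → ℝ} (ha : IsProbVec a) {x : ℝ}
    (hx : x ∈ Ioc (0 : ℝ) 1) : ∃ i, x ∈ Jtil a i := by
  classical
  have hex : ∃ k, x ≤ bpt a k := ⟨n, ha.bpt_card ▸ hx.2⟩
  have hspec := Nat.find_spec hex
  have hle : Nat.find hex ≤ n := Nat.find_min' hex (ha.bpt_card ▸ hx.2)
  obtain ⟨k, hk⟩ : ∃ k, Nat.find hex = k + 1 := Nat.exists_eq_succ_of_ne_zero fun h0 => by
    rw [h0, bpt_zero] at hspec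
    exact hspec.not_gt hx.1
  exact ⟨⟨k, by omega⟩, not_le.1 (Nat.find_min hex (k.lt_succ_self.trans_eq hk.symm)), hk ▸ hspec⟩

theorem IsProbVec.eq_of_mem_Jint {n : ℕ} {a : Fin n → ℝ} (ha : IsProbVec a) {x : ℝ} {i j : Fin n}
    (hi : x ∈ Jint a i) (hj : x ∈ Jint a j) : i = j := by
  by_contra hij
  rcases lt_or_gt_of_ne hij with h | h
  · exact ((ha.bpt_mono (Nat.succ_le_of_lt h)).trans hj.1).not_gt hi.2
  · exact ((ha.bpt_mono (Nat.succ_le_of_lt h)).trans hi.1).not_gt hj.2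

theorem IsProbVec.eq_of_mem_Jtil {n : ℕ} {a : Fin n → ℝ} (ha : IsProbVec a) {x : ℝ} {i j : Fin n}
    (hi : x ∈ Jtil a i) (hj : x ∈ Jtil a j) : i = j := by
  by_contra hij
  rcases lt_or_gt_of_ne hij with h | h
  · exact (hi.2.trans (ha.bpt_mono (Nat.succ_le_of_lt h))).not_gt hj.1
  · exact (hj.2.trans (ha.bpt_mono (Nat.succ_le_of_lt h))).not_gt hi.1

theorem bpt_aperm_succ {n : ℕ} (a : Fin n → ℝ) (τ : Equiv.Perm (Fin n)) (i : Fin n) :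
    bpt (aperm a τ) ((τ i : ℕ) + 1) = bpt (aperm a τ) (τ i : ℕ) + a i := by
  rw [bpt_succ, aperm, Equiv.symm_apply_apply]

section

variable {n : ℕ} {a : Fin n → ℝ} {τ : Equiv.Perm (Fin n)} {T S : ℝ → ℝ}

theorem IsLrIET.mem_Jint (hT : IsLrIET a τ T) {i : Fin n} {x : ℝ} (hx : x ∈ Jint a i) :
    T x ∈ Jint (aperm a τ) (τ i) := by
  have h₁ := bpt_succ a i
  have h₂ := bpt_aperm_succ a τ i
  obtain ⟨h₃, h₄⟩ := hx
  rw [hT i x ⟨h₃, h₄⟩]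
  constructor <;> linarith

theorem IslRIET.mem_Jtil (hS : IslRIET a τ S) {i : Fin n} {x : ℝ} (hx : x ∈ Jtil a i) :
    S x ∈ Jtil (aperm a τ) (τ i) := by
  have h₁ := bpt_succ a i
  have h₂ := bpt_aperm_succ a τ i
  obtain ⟨h₃, h₄⟩ := hx
  rw [hS i x ⟨h₃, h₄⟩]
  constructor <;> linarith

theorem IsLrIET.mapsTo (hT : IsLrIET a τ T) (ha : IsProbVec a) :
    MapsTo T (Ico 0 1) (Ico 0 1) := fun _ hx =>
  let ⟨_, hi⟩ := ha.exists_mem_Jint hx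
  (ha.aperm τ).Jint_subset _ (hT.mem_Jint hi)

theorem IslRIET.mapsTo (hS : IslRIET a τ S) (ha : IsProbVec a) :
    MapsTo S (Ioc 0 1) (Ioc 0 1) := fun _ hx =>
  let ⟨_, hi⟩ := ha.exists_mem_Jtil hx
  (ha.aperm τ).Jtil_subset _ (hS.mem_Jtil hi)

theorem IsLrIET.injOn (hT : IsLrIET a τ T) (ha : IsProbVec a) : InjOn T (Ico 0 1) := by
  intro x hx y hy hxy
  obtain ⟨i, hi⟩ := ha.exists_mem_Jint hx
  obtain ⟨j, hj⟩ := ha.exists_mem_Jint hy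
  obtain rfl : i = j := τ.injective <|
    (ha.aperm τ).eq_of_mem_Jint (hT.mem_Jint hi) (hxy ▸ hT.mem_Jint hj)
  rw [hT i x hi, hT i y hj] at hxy
  linarith

theorem IslRIET.injOn (hS : IslRIET a τ S) (ha : IsProbVec a) : InjOn S (Ioc 0 1) := by
  intro x hx y hy hxy
  obtain ⟨i, hi⟩ := ha.exists_mem_Jtil hx
  obtain ⟨j, hj⟩ := ha.exists_mem_Jtil hy
  obtain rfl : i = j := τ.injective <|
    (ha.aperm τ).eq_of_mem_Jtil (hS.mem_Jtil hi) (hxy ▸ hS.mem_Jtil hj)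
  rw [hS i x hi, hS i y hj] at hxy
  linarith

theorem IsLrIET.apply_bpt (hT : IsLrIET a τ T) (ha : IsProbVec a) (i : Fin n) :
    T (bpt a (i : ℕ)) = bpt (aperm a τ) (τ i : ℕ) := by
  rw [hT i _ ⟨le_rfl, ha.bpt_lt (Nat.lt_succ_self _) i.isLt⟩, sub_self, zero_add]

theorem IslRIET.apply_bpt_succ (hS : IslRIET a τ S) (ha : IsProbVec a) (i : Fin n) :
    S (bpt a ((i : ℕ) + 1)) = bpt (aperm a τ) ((τ i : ℕ) + 1) := by
  rw [hS i _ ⟨ha.bpt_lt (Nat.lt_succ_self _) i.isLt, le_rfl⟩, bpt_succ, bpt_aperm_succ]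
  ring

theorem IsLrIET.eq_of_notMem_Dset (hT : IsLrIET a τ T) (hS : IslRIET a τ S) (ha : IsProbVec a)
    {x : ℝ} (hx : x ∈ Ioo (0 : ℝ) 1) (hxD : x ∉ Dset a) : T x = S x := by
  obtain ⟨i, hi⟩ := ha.exists_mem_Jint ⟨hx.1.le, hx.2⟩
  have hne : bpt a (i : ℕ) ≠ x := fun h => by
    have hmem := (mem_insert_zero_Dset_iff i.pos a x).2 ⟨i, h.symm⟩
    exact hmem.elim hx.1.ne' hxD
  rw [hT i x hi, hS i x ⟨hi.1.lt_of_ne hne, hi.2.le⟩]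

theorem exists_iterate_mem_Dset_iff (hn : 0 < n) (ha : IsProbVec a) (hT : IsLrIET a τ T)
    (hS : IslRIET a τ S) :
    (∃ k : ℕ, 0 < k ∧ ∃ x ∈ Dset a, T^[k] x ∈ Dset a) ↔
      ∃ k : ℕ, 0 < k ∧ ∃ x ∈ Dset a, S^[k] x ∈ Dset a := by
  have hIco : insert (0 : ℝ) (Ioo 0 1) = Ico 0 1 := Ioo_insert_left one_pos
  have hIoc : insert (1 : ℝ) (Ioo 0 1) = Ioc 0 1 := Ioo_insert_right one_pos
  have hzero : ∃ x ∈ insert 0 (Dset a), T x = 0 := by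
    refine ⟨_, (mem_insert_zero_Dset_iff hn a _).2 ⟨τ.symm ⟨0, hn⟩, rfl⟩, ?_⟩
    rw [hT.apply_bpt ha, Equiv.apply_symm_apply, bpt_zero]
  have hone : ∃ y ∈ insert 1 (Dset a), S y = 1 := by
    refine ⟨_, (ha.mem_insert_one_Dset_iff hn _).2 ⟨τ.symm ⟨n - 1, by omega⟩, rfl⟩, ?_⟩
    rw [hS.apply_bpt_succ ha, Equiv.apply_symm_apply]
    simp only [Nat.sub_add_cancel hn]
    exact (ha.aperm τ).bpt_card
  constructor
  · refine exists_iterate_mem_of_exists_iterate_mem (p := 0) (q := 1) ha.Dset_subset (by simp)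
      (by simp) (hIco ▸ hT.mapsTo ha) (hIco ▸ hT.injOn ha)
      (fun x hx hxD => hT.eq_of_notMem_Dset hS ha hx hxD) (fun x hx => ?_) hzero hone
    obtain ⟨i, rfl⟩ := (mem_insert_zero_Dset_iff hn a x).1 hx
    rw [hT.apply_bpt ha]
    rcases Nat.eq_zero_or_pos (τ i : ℕ) with h0 | h0
    · exact Or.inl (by rw [h0, bpt_zero])
    · refine Or.inr ⟨_, (ha.mem_insert_one_Dset_iff hn _).2
        ⟨τ.symm ⟨(τ i : ℕ) - 1, by omega⟩, rfl⟩, ?_⟩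
      rw [hS.apply_bpt_succ ha, Equiv.apply_symm_apply]
      simp only [Nat.sub_add_cancel h0]
  · refine exists_iterate_mem_of_exists_iterate_mem (p := 1) (q := 0) ha.Dset_subset (by simp)
      (by simp) (hIoc ▸ hS.mapsTo ha) (hIoc ▸ hS.injOn ha)
      (fun x hx hxD => (hT.eq_of_notMem_Dset hS ha hx hxD).symm) (fun y hy => ?_) hone hzero
    obtain ⟨i, rfl⟩ := (ha.mem_insert_one_Dset_iff hn y).1 hy
    rw [hS.apply_bpt_succ ha]
    rcases (Nat.succ_le_of_lt (τ i).isLt).eq_or_lt with h1 | h1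
    · exact Or.inl (by rw [← Nat.succ_eq_add_one, h1, (ha.aperm τ).bpt_card])
    · refine Or.inr ⟨_, (mem_insert_zero_Dset_iff hn a _).2
        ⟨τ.symm ⟨(τ i : ℕ) + 1, h1⟩, rfl⟩, ?_⟩
      rw [hT.apply_bpt ha, Equiv.apply_symm_apply]

end

theorem forall_inter_image_iterate_eq_empty_iff {X : Type*} (T : X → X) (D : Set X) :
    (∀ k : ℕ, 0 < k → D ∩ (T^[k] '' D) = ∅) ↔ ¬ ∃ k : ℕ, 0 < k ∧ ∃ x ∈ D, T^[k] x ∈ D := by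
  simp only [Set.eq_empty_iff_forall_notMem, mem_inter_iff, mem_image]
  grind

/-- Lemma 3.3: `D ∩ T^k(D) = ∅` for all positive integers `k` if and
only if `D ∩ T̃^k(D) = ∅` for all positive integers `k`. -/
theorem stmt7 {n : ℕ} (hn : 2 ≤ n) (a : Fin n → ℝ) (ha : IsProbVec a)
    (τ : Equiv.Perm (Fin n)) (T Tt : ℝ → ℝ)
    (hT : IsLrIET a τ T) (hTt : IslRIET a τ Tt) :
    (∀ k : ℕ, 0 < k → Dset a ∩ (T^[k] '' Dset a) = ∅) ↔
    (∀ k : ℕ, 0 < k → Dset a ∩ (Tt^[k] '' Dset a) = ∅) := by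
  rw [forall_inter_image_iterate_eq_empty_iff, forall_inter_image_iterate_eq_empty_iff,
    exists_iterate_mem_Dset_iff (by omega) ha hT hTt]
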